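/- arXiv:2406.00689 — 2 statements merged into one kernel-verified Lean document; each statement's English description precedes it below -/
import Mathlib

section
/- Let E ∈ ℂ^{n×n} be a Hermitian positive definite matrix. Over all Hermitian positive definite matrices W ∈ ℂ^{n×n}, the function W ↦ log det W − tr(W E) (where det and tr denote the real logarithm of the positive real determinant and the real trace, respectively) attains its maximum uniquely at W = E⁻¹, with maximum value −log det E − n; that is, for every Hermitian positive definite W ≠ E⁻¹, log det W − tr(W E) < −log det E − n. -/
open Matrix ComplexOrder

/-- A positive definite matrix other than the identity satisfies `log det A - tr A < -n`. -/
theorem Matrix.PosDef.log_det_sub_trace_lt {ι : Type*} [Fintype ι] [DecidableEq ι]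
    {A : Matrix ι ι ℂ} (hA : A.PosDef) (h1 : A ≠ 1) :
    Real.log A.det.re - A.trace.re < -Fintype.card ι := by
  have hpos := hA.eigenvalues_pos
  have hdet : A.det.re = ∏ i, hA.1.eigenvalues i := by
    have h : A.det = ((∏ i, hA.1.eigenvalues i : ℝ) : ℂ) := by
      rw [hA.1.det_eq_prod_eigenvalues]
      push_cast
      rfl
    rw [h, Complex.ofReal_re]
  have htr : A.trace.re = ∑ i, hA.1.eigenvalues i := by
    have h : A.trace = ((∑ i, hA.1.eigenvalues i : ℝ) : ℂ) := by
      rw [hA.1.trace_eq_sum_eigenvalues]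
      push_cast
      rfl
    rw [h, Complex.ofReal_re]
  obtain ⟨j, hj⟩ : ∃ j, hA.1.eigenvalues j ≠ 1 := by
    by_contra! hall
    apply h1
    have hone : hA.1.eigenvalues = fun _ => 1 := funext hall
    rw [hA.1.spectral_theorem, hone]
    simp [Function.comp_def]
  rw [hdet, htr, Real.log_prod fun i _ => (hpos i).ne', ← Finset.sum_sub_distrib]
  calc ∑ i, (Real.log (hA.1.eigenvalues i) - hA.1.eigenvalues i) < ∑ _i : ι, (-1 : ℝ) :=
        Finset.sum_lt_sum
          (fun i _ => by linarith [Real.log_le_sub_one_of_pos (hpos i)])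
          ⟨j, Finset.mem_univ j, by linarith [Real.log_lt_sub_one_of_pos (hpos j) hj]⟩
    _ = -Fintype.card ι := by simp

open scoped MatrixOrder Matrix.Norms.L2Operator in
/-- A positive definite matrix factors as `Bᴴ * B` with `B` invertible. -/
theorem Matrix.PosDef.exists_isUnit_eq_conjTranspose_mul_self {ι : Type*} [Fintype ι]
    [DecidableEq ι] {A : Matrix ι ι ℂ} (hA : A.PosDef) :
    ∃ B : Matrix ι ι ℂ, IsUnit B ∧ A = Bᴴ * B := by
  obtain ⟨B, hB⟩ := CStarAlgebra.nonneg_iff_eq_star_mul_self.mp hA.posSemidef.nonneg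
  refine ⟨B, ?_, hB⟩
  have h := hA.isUnit
  rw [hB, Matrix.isUnit_iff_isUnit_det, Matrix.det_mul] at h
  exact (Matrix.isUnit_iff_isUnit_det B).mpr (isUnit_of_mul_isUnit_right h)

/-- For a Hermitian positive definite `E`, over Hermitian positive definite `W`
the function `W ↦ log det W − tr(W E)` (real log of the positive real
determinant, real trace) attains its maximum uniquely at `W = E⁻¹`, with value
`−log det E − n`: the value at `E⁻¹` equals `−log det E − n`, and for every
Hermitian positive definite `W ≠ E⁻¹` the value is strictly smaller. -/
theorem wmmse_optimal_weight {n : ℕ} (E : Matrix (Fin n) (Fin n) ℂ) (hE : E.PosDef) :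
    (Real.log ((E⁻¹).det.re) - ((E⁻¹ * E).trace).re = - Real.log (E.det.re) - n) ∧
    ∀ W : Matrix (Fin n) (Fin n) ℂ, W.PosDef → W ≠ E⁻¹ →
      Real.log (W.det.re) - ((W * E).trace).re < - Real.log (E.det.re) - n := by
  have hdetE : 0 < E.det.re ∧ 0 = E.det.im := Complex.lt_def.mp hE.det_pos
  have hunit : IsUnit E.det := hE.det_pos.ne'.isUnit
  have hE_real : E.det = (E.det.re : ℂ) := Complex.ext rfl hdetE.2.symm
  constructor
  · have hinv : (E⁻¹).det.re = (E.det.re)⁻¹ := by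
      rw [Matrix.det_nonsing_inv, Ring.inverse_eq_inv', hE_real, ← Complex.ofReal_inv,
        Complex.ofReal_re, Complex.ofReal_re]
    rw [hinv, Real.log_inv, Matrix.nonsing_inv_mul E hunit]
    simp
  · intro W hW hne
    obtain ⟨B, hB, rfl⟩ := hE.exists_isUnit_eq_conjTranspose_mul_self
    have hdetW : 0 < W.det.re ∧ 0 = W.det.im := Complex.lt_def.mp hW.det_pos
    have hA : (B * W * Bᴴ).PosDef :=
      hW.mul_mul_conjTranspose_same (Matrix.vecMul_injective_of_isUnit hB)
    have hdet : (B * W * Bᴴ).det.re = W.det.re * (Bᴴ * B).det.re := by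
      have h : (B * W * Bᴴ).det = W.det * (Bᴴ * B).det := by
        simp only [Matrix.det_mul]
        ring
      rw [h, Complex.mul_re, ← hdetW.2]
      simp
    have htr : (B * W * Bᴴ).trace = (W * (Bᴴ * B)).trace := by
      rw [Matrix.mul_assoc, Matrix.trace_mul_comm, Matrix.mul_assoc]
    have hne_one : B * W * Bᴴ ≠ 1 := by
      intro h
      refine hne (Matrix.inv_eq_left_inv ?_).symm
      have h' : W * Bᴴ * B = 1 := mul_eq_one_comm.mp (by rwa [← Matrix.mul_assoc])
      rwa [← Matrix.mul_assoc]
    have key := hA.log_det_sub_trace_lt hne_one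
    rw [hdet, htr, Real.log_mul hdetW.1.ne' hdetE.1.ne', Fintype.card_fin] at key
    linarith
end

section
/- Let T ∈ ℂ^{N_U × N_S} and σ > 0, and for Q ∈ ℂ^{N_U × N_S} define E(Q) = (Q^H T − I_{N_S})(Q^H T − I_{N_S})^H + σ² Q^H Q. Then the supremum, over all Q ∈ ℂ^{N_U × N_S} and all Hermitian positive definite W ∈ ℂ^{N_S × N_S}, of ξ(W, Q) = log det W − tr(W E(Q)) + N_S equals log det(I_{N_U} + σ⁻² T T^H), and it is attained at Q* = (σ² I_{N_U} + T T^H)⁻¹ T and W* = E(Q*)⁻¹. -/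
open Matrix ComplexOrder

/-- The MSE matrix for information decoding with effective channel `T`,
decoder `Q` and noise power `σ²`:
`E(Q) = (Qᴴ T − I)(Qᴴ T − I)ᴴ + σ² Qᴴ Q`. -/
noncomputable def mseMatrix {NU NS : ℕ} (σ : ℝ) (T Q : Matrix (Fin NU) (Fin NS) ℂ) :
    Matrix (Fin NS) (Fin NS) ℂ :=
  (Qᴴ * T - 1) * (Qᴴ * T - 1)ᴴ + ((σ : ℂ) ^ 2) • (Qᴴ * Q)

namespace Matrix

variable {m n : Type*} [Fintype m] [Fintype n]

open scoped MatrixOrder in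
theorem PosSemidef.exists_eq_conjTranspose_mul_self {A : Matrix n n ℂ} (hA : A.PosSemidef) :
    ∃ C : Matrix n n ℂ, A = Cᴴ * C := by
  classical
  exact CStarAlgebra.nonneg_iff_eq_star_mul_self.mp hA.nonneg

theorem PosDef.log_det_le_trace_sub_card [DecidableEq n] {M : Matrix n n ℂ} (hM : M.PosDef) :
    Real.log M.det.re ≤ M.trace.re - Fintype.card n := by
  have hdet : M.det.re = ∏ i, hM.1.eigenvalues i := by
    rw [hM.1.det_eq_prod_eigenvalues]
    norm_cast
  have htrace : M.trace.re = ∑ i, hM.1.eigenvalues i := by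
    rw [hM.1.trace_eq_sum_eigenvalues]
    norm_cast
  rw [hdet, htrace, Real.log_prod fun i _ => (hM.eigenvalues_pos i).ne']
  calc ∑ i, Real.log (hM.1.eigenvalues i)
      ≤ ∑ i, (hM.1.eigenvalues i - 1) :=
        Finset.sum_le_sum fun i _ => Real.log_le_sub_one_of_pos (hM.eigenvalues_pos i)
    _ = _ := by simp

theorem PosSemidef.trace_mul_nonneg {W P : Matrix n n ℂ} (hW : W.PosSemidef)
    (hP : P.PosSemidef) : 0 ≤ (W * P).trace := by
  obtain ⟨C, rfl⟩ := hW.exists_eq_conjTranspose_mul_self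
  rw [Matrix.mul_assoc, trace_mul_comm]
  exact (hP.mul_mul_conjTranspose_same C).trace_nonneg

theorem PosDef.log_det_add_card_le [DecidableEq n]
    {W B : Matrix n n ℂ} (hW : W.PosDef) (hB : B.PosDef) :
    Real.log W.det.re - (W * B⁻¹).trace.re + Fintype.card n ≤ Real.log B.det.re := by
  obtain ⟨C, hC⟩ := hB.inv.posSemidef.exists_eq_conjTranspose_mul_self
  have hCunit : IsUnit C := by
    have h := hB.inv.isUnit
    rw [hC, isUnit_iff_isUnit_det, det_mul] at h
    exact (isUnit_iff_isUnit_det C).mpr (isUnit_of_mul_isUnit_right h)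
  have hM : (C * W * Cᴴ).PosDef := by
    simpa [star_eq_conjTranspose] using (hCunit.posDef_star_right_conjugate_iff (x := W)).mpr hW
  have htrace : (C * W * Cᴴ).trace = (W * B⁻¹).trace := by
    rw [hC, Matrix.mul_assoc, trace_mul_comm, Matrix.mul_assoc]
  have hdet : (C * W * Cᴴ).det * B.det = W.det := by
    have h : B⁻¹.det * B.det = 1 := by
      rw [← det_mul, nonsing_inv_mul _ ((isUnit_iff_isUnit_det B).mp hB.isUnit), det_one]
    rw [hC, det_mul] at h
    rw [det_mul, det_mul]
    linear_combination W.det * h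
  have hMpos := Complex.pos_iff.mp hM.det_pos
  have hBpos := Complex.pos_iff.mp hB.det_pos
  have hre : W.det.re = (C * W * Cᴴ).det.re * B.det.re := by
    rw [← hdet, Complex.mul_re, ← hBpos.2]
    ring
  have h := hM.log_det_le_trace_sub_card
  rw [htrace] at h
  rw [hre, Real.log_mul hMpos.1.ne' hBpos.1.ne']
  linarith

theorem posDef_one_add_smul_conjTranspose_mul_self [DecidableEq n]
    (T : Matrix m n ℂ) {s : ℂ} (hs : 0 < s) :
    (1 + s⁻¹ • (Tᴴ * T)).PosDef :=
  PosDef.one.add_posSemidef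
    ((posSemidef_conjTranspose_mul_self T).smul (inv_pos.mpr hs).le)

theorem posDef_smul_one_add_mul_conjTranspose_self [DecidableEq m]
    (T : Matrix m n ℂ) {s : ℂ} (hs : 0 < s) :
    (s • (1 : Matrix m m ℂ) + T * Tᴴ).PosDef :=
  (PosDef.one.smul hs).add_posSemidef (posSemidef_self_mul_conjTranspose T)

theorem inv_one_add_smul_conjTranspose_mul_self [DecidableEq m] [DecidableEq n]
    (T : Matrix m n ℂ) {s : ℂ} (hs : 0 < s) :
    (1 + s⁻¹ • (Tᴴ * T))⁻¹ = 1 - Tᴴ * ((s • (1 : Matrix m m ℂ) + T * Tᴴ)⁻¹ * T) := by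
  have hA := posDef_smul_one_add_mul_conjTranspose_self T hs
  set A := s • (1 : Matrix m m ℂ) + T * Tᴴ with hA_def
  have hAQ : A * (A⁻¹ * T) = T :=
    mul_nonsing_inv_cancel_left _ _ ((isUnit_iff_isUnit_det A).mp hA.isUnit)
  generalize A⁻¹ * T = Q at hAQ ⊢
  have hT : T = s • Q + T * (Tᴴ * Q) := by
    nth_rewrite 1 [← hAQ]
    rw [hA_def, Matrix.add_mul, Matrix.smul_mul, Matrix.one_mul, Matrix.mul_assoc]
  have hTT : Tᴴ * T = s • (Tᴴ * Q) + Tᴴ * (T * (Tᴴ * Q)) := by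
    nth_rewrite 2 [hT]
    rw [Matrix.mul_add, Matrix.mul_smul]
  apply inv_eq_right_inv
  have h : s⁻¹ • (Tᴴ * T) = Tᴴ * Q + s⁻¹ • (Tᴴ * (T * (Tᴴ * Q))) := by
    nth_rewrite 1 [hTT]
    rw [smul_add, inv_smul_smul₀ hs.ne']
  rw [Matrix.mul_sub, Matrix.mul_one, Matrix.add_mul, Matrix.one_mul, Matrix.smul_mul,
    Matrix.mul_assoc, h]
  abel

end Matrix

/-- Completing the square in the MSE matrix around the MMSE receiver. -/
theorem mseMatrix_eq {NU NS : ℕ} (T Q : Matrix (Fin NU) (Fin NS) ℂ) {σ : ℝ} (hσ : 0 < σ) :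
    mseMatrix σ T Q =
      (Q - ((σ : ℂ) ^ 2 • (1 : Matrix (Fin NU) (Fin NU) ℂ) + T * Tᴴ)⁻¹ * T)ᴴ *
        ((σ : ℂ) ^ 2 • (1 : Matrix (Fin NU) (Fin NU) ℂ) + T * Tᴴ) *
        (Q - ((σ : ℂ) ^ 2 • (1 : Matrix (Fin NU) (Fin NU) ℂ) + T * Tᴴ)⁻¹ * T) +
      (1 + ((σ : ℂ) ^ 2)⁻¹ • (Tᴴ * T))⁻¹ := by
  have hs : (0 : ℂ) < (σ : ℂ) ^ 2 := by exact_mod_cast pow_pos hσ 2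
  rw [inv_one_add_smul_conjTranspose_mul_self T hs, mseMatrix]
  have hA := posDef_smul_one_add_mul_conjTranspose_self T hs
  set A := (σ : ℂ) ^ 2 • (1 : Matrix (Fin NU) (Fin NU) ℂ) + T * Tᴴ with hA_def
  have hAQ : A * (A⁻¹ * T) = T :=
    mul_nonsing_inv_cancel_left _ _ ((isUnit_iff_isUnit_det A).mp hA.isUnit)
  generalize A⁻¹ * T = R at hAQ ⊢
  have hRA : Rᴴ * A = Tᴴ := by
    rw [← hAQ, conjTranspose_mul, hA.1.eq]
  have hQ : Qᴴ * A * Q = (σ : ℂ) ^ 2 • (Qᴴ * Q) + Qᴴ * T * (Tᴴ * Q) := by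
    rw [hA_def]
    simp only [Matrix.mul_add, Matrix.add_mul, Matrix.mul_smul, Matrix.smul_mul, Matrix.one_mul,
      Matrix.mul_assoc]
  have hsquare : (Q - R)ᴴ * A * (Q - R) = Qᴴ * A * Q - Qᴴ * T - Tᴴ * Q + Tᴴ * R := by
    rw [conjTranspose_sub, Matrix.sub_mul, hRA, Matrix.mul_sub, Matrix.sub_mul, Matrix.sub_mul,
      Matrix.mul_assoc Qᴴ A R, hAQ]
    abel
  rw [hsquare, hQ]
  simp only [conjTranspose_sub, conjTranspose_mul, conjTranspose_conjTranspose,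
    conjTranspose_one, Matrix.mul_sub, Matrix.sub_mul, Matrix.mul_one, Matrix.one_mul]
  abel

/-- WMMSE rate equivalence: the supremum over decoders `Q` and Hermitian
positive definite weights `W` of `ξ(W,Q) = log det W − tr(W E(Q)) + N_S`
equals the achievable rate `log det (I + σ⁻² T Tᴴ)`, and it is attained at
`Q* = (σ² I + T Tᴴ)⁻¹ T` and `W* = E(Q*)⁻¹`. -/
theorem wmmse_rate_equivalence {NU NS : ℕ} (T : Matrix (Fin NU) (Fin NS) ℂ)
    (σ : ℝ) (hσ : 0 < σ) :
    IsGreatest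
      {x : ℝ | ∃ (Q : Matrix (Fin NU) (Fin NS) ℂ) (W : Matrix (Fin NS) (Fin NS) ℂ),
          W.PosDef ∧
          x = Real.log (W.det.re) - ((W * mseMatrix σ T Q).trace).re + NS}
      (Real.log (((1 : Matrix (Fin NU) (Fin NU) ℂ) + (((σ : ℂ) ^ 2)⁻¹) • (T * Tᴴ)).det.re)) ∧
    ((mseMatrix σ T ((((σ : ℂ) ^ 2) • (1 : Matrix (Fin NU) (Fin NU) ℂ) + T * Tᴴ)⁻¹ * T))⁻¹).PosDef ∧
    Real.log (((mseMatrix σ T ((((σ : ℂ) ^ 2) • (1 : Matrix (Fin NU) (Fin NU) ℂ) + T * Tᴴ)⁻¹ * T))⁻¹).det.re)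
      - (((mseMatrix σ T ((((σ : ℂ) ^ 2) • (1 : Matrix (Fin NU) (Fin NU) ℂ) + T * Tᴴ)⁻¹ * T))⁻¹ *
          mseMatrix σ T ((((σ : ℂ) ^ 2) • (1 : Matrix (Fin NU) (Fin NU) ℂ) + T * Tᴴ)⁻¹ * T)).trace).re
      + NS =
      Real.log (((1 : Matrix (Fin NU) (Fin NU) ℂ) + (((σ : ℂ) ^ 2)⁻¹) • (T * Tᴴ)).det.re) := by
  have hs : (0 : ℂ) < (σ : ℂ) ^ 2 := by exact_mod_cast pow_pos hσ 2
  have hB := posDef_one_add_smul_conjTranspose_mul_self T hs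
  have hA := posDef_smul_one_add_mul_conjTranspose_self T hs
  have hdet : ((1 : Matrix (Fin NU) (Fin NU) ℂ) + ((σ : ℂ) ^ 2)⁻¹ • (T * Tᴴ)).det =
      (1 + ((σ : ℂ) ^ 2)⁻¹ • (Tᴴ * T)).det := by
    rw [← Matrix.mul_smul, det_one_add_mul_comm, Matrix.smul_mul]
  have hE : mseMatrix σ T
      (((σ : ℂ) ^ 2 • (1 : Matrix (Fin NU) (Fin NU) ℂ) + T * Tᴴ)⁻¹ * T) =
      (1 + ((σ : ℂ) ^ 2)⁻¹ • (Tᴴ * T))⁻¹ := by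
    rw [mseMatrix_eq T _ hσ]
    simp
  have hunit := (isUnit_iff_isUnit_det _).mp hB.isUnit
  have hval : Real.log (1 + ((σ : ℂ) ^ 2)⁻¹ • (Tᴴ * T)).det.re
      - ((1 + ((σ : ℂ) ^ 2)⁻¹ • (Tᴴ * T)) * (1 + ((σ : ℂ) ^ 2)⁻¹ • (Tᴴ * T))⁻¹).trace.re + NS =
      Real.log (1 + ((σ : ℂ) ^ 2)⁻¹ • (Tᴴ * T)).det.re := by
    rw [mul_nonsing_inv _ hunit]
    simp
  rw [hE, nonsing_inv_nonsing_inv _ hunit, hdet]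
  refine ⟨⟨⟨_, _, hB, by rw [hE, hval]⟩, ?_⟩, hB, hval⟩
  rintro x ⟨Q, W, hW, rfl⟩
  have hbound := hW.log_det_add_card_le hB
  rw [Fintype.card_fin] at hbound
  rw [mseMatrix_eq T Q hσ, Matrix.mul_add, trace_add, Complex.add_re]
  have hexcess := (Complex.nonneg_iff.mp (hW.posSemidef.trace_mul_nonneg
    (hA.posSemidef.conjTranspose_mul_mul_same
      (Q - ((σ : ℂ) ^ 2 • (1 : Matrix (Fin NU) (Fin NU) ℂ) + T * Tᴴ)⁻¹ * T)))).1
  linarith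
end
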